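/- Under the hypotheses of the constrained least-squares lemma, if only a single coordinate j of Y is constrained to zero (C is a single standard basis vector e_j), then the minimum value equals ‖AY_full − b‖² + |Y_full(j)|² / ((A*A)^{-1})_{jj}. -/

import Mathlib

open Matrix

theorem ofReal_sum_norm_sq_eq_star_dotProduct {ι : Type*} [Fintype ι] (v : ι → ℂ) :
    ((∑ i, ‖v i‖ ^ 2 : ℝ) : ℂ) = star v ⬝ᵥ v := by
  simp [dotProduct, Complex.conj_mul']

theorem sum_norm_add_sq_of_star_dotProduct_eq_zero {ι : Type*} [Fintype ι] {u v : ι → ℂ}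
    (h : star u ⬝ᵥ v = 0) :
    ∑ i, ‖(u + v) i‖ ^ 2 = ∑ i, ‖u i‖ ^ 2 + ∑ i, ‖v i‖ ^ 2 := by
  have h' : star v ⬝ᵥ u = 0 := by
    rw [← star_star (star v ⬝ᵥ u), star_dotProduct, star_star, dotProduct_comm, dotProduct_comm, h,
      star_zero]
  apply Complex.ofReal_injective
  rw [Complex.ofReal_add]
  simp only [ofReal_sum_norm_sq_eq_star_dotProduct]
  rw [star_add, add_dotProduct, dotProduct_add, dotProduct_add, h, h']
  ring

open scoped ComplexOrder in
theorem diag_inv_conjTranspose_mul_self {m n : Type*} [Fintype m] [Fintype n] [DecidableEq n]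
    {A : Matrix m n ℂ} (hA : IsUnit (Aᴴ * A)) (j : n) :
    (Aᴴ * A)⁻¹ j j ≠ 0 ∧ star ((Aᴴ * A)⁻¹ j j) = (Aᴴ * A)⁻¹ j j := by
  have hpos : (Aᴴ * A)⁻¹.PosDef :=
    ((posSemidef_conjTranspose_mul_self A).posDef_iff_isUnit.2 hA).inv
  exact ⟨hpos.diag_pos.ne', hpos.isHermitian.apply j j⟩

/-- with a single coordinate j constrained to zero, the
constrained least-squares minimum equals
‖AY_full − b‖² + |Y_full(j)|² / ((A*A)⁻¹)_{jj}. -/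
theorem stmt4 {m n : ℕ} (A : Matrix (Fin m) (Fin n) ℂ) (b : Fin m → ℂ)
    (hA : IsUnit (Aᴴ * A)) (j : Fin n) :
    let obj : (Fin n → ℂ) → ℝ := fun Y => ∑ i, ‖A.mulVec Y i - b i‖ ^ 2
    let Yfull : Fin n → ℂ := (Aᴴ * A)⁻¹.mulVec (Aᴴ.mulVec b)
    ∃ δ2 : ℝ,
      IsLeast {r : ℝ | ∃ Y : Fin n → ℂ, Y j = 0 ∧ r = obj Y} δ2 ∧
      (δ2 : ℂ) = (obj Yfull : ℂ) + (‖Yfull j‖ ^ 2 : ℂ) / (Aᴴ * A)⁻¹ j j := by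
  intro obj Yfull
  have hdet : IsUnit (Aᴴ * A).det := (isUnit_iff_isUnit_det _).1 hA
  obtain ⟨hg, hgs⟩ := diag_inv_conjTranspose_mul_self hA j
  set g := (Aᴴ * A)⁻¹ j j with hgdef
  set w : Fin n → ℂ := (Aᴴ * A)⁻¹ *ᵥ Pi.single j 1 with hw
  have hwj : w j = g := by simp [hw, hgdef]
  have hGw : Aᴴ *ᵥ (A *ᵥ w) = Pi.single j 1 := by
    rw [hw, mulVec_mulVec, mulVec_mulVec, mul_nonsing_inv _ hdet, one_mulVec]
  have hfull : Aᴴ *ᵥ (A *ᵥ Yfull - b) = 0 := by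
    simp only [Yfull]
    rw [mulVec_sub, mulVec_mulVec, mulVec_mulVec, mul_nonsing_inv _ hdet, one_mulVec, sub_self]
  have hadj (D : Fin n → ℂ) (v : Fin m → ℂ) : star (A *ᵥ D) ⬝ᵥ v = star D ⬝ᵥ (Aᴴ *ᵥ v) := by
    rw [star_mulVec, dotProduct_mulVec]
  have hobj (Y D : Fin n → ℂ) (h : star D ⬝ᵥ (Aᴴ *ᵥ (A *ᵥ Y - b)) = 0) :
      obj (D + Y) = ∑ i, ‖(A *ᵥ D) i‖ ^ 2 + obj Y := by
    have := sum_norm_add_sq_of_star_dotProduct_eq_zero ((hadj D (A *ᵥ Y - b)).trans h)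
    rw [← add_sub_assoc, ← mulVec_add] at this
    exact this
  set c : ℂ := -(Yfull j / g) with hc
  refine ⟨obj (c • w + Yfull), ⟨⟨_, ?_, rfl⟩, ?_⟩, ?_⟩
  · simp [hwj, hc, hg]
  · rintro _ ⟨Y, hY, rfl⟩
    have h := hobj (c • w + Yfull) (Y - (c • w + Yfull)) (by
      rw [mulVec_add, add_sub_assoc, mulVec_add, hfull, add_zero, mulVec_smul, mulVec_smul, hGw]
      simp [hwj, hY, hc, hg])
    rw [sub_add_cancel] at h
    rw [h]
    exact le_add_of_nonneg_left (Finset.sum_nonneg fun i _ => sq_nonneg _)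
  · rw [hobj Yfull (c • w) (by rw [hfull, dotProduct_zero]), Complex.ofReal_add,
      ofReal_sum_norm_sq_eq_star_dotProduct, hadj, mulVec_smul, mulVec_smul, hGw, add_comm]
    congr 1
    have hn : ((‖Yfull j‖ : ℂ)) ^ 2 = star (Yfull j) * Yfull j := (Complex.conj_mul' _).symm
    rw [hn]
    have : star (c • w) ⬝ᵥ (c • Pi.single j (1 : ℂ)) = star c * star g * c := by
      simp [hwj]
      ring
    rw [this, hc, star_neg, star_div₀, hgs]
    field_simp
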